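/- arXiv:1701.04888 — 3 statements merged into one kernel-verified Lean document; each statement's English description precedes it below -/
import Mathlib

section
/- Let Ĝ be a swap-maximal loopy graph. Then for every vertex u ∈ V^0, every v ∈ N(u), and every vertex x ∈ N(u) with x ≠ v, the edge (v,x) is present in Ĝ (i.e., x ∈ N(v)). -/
open scoped Classical

/-- A loopy graph: at most one edge between any two distinct vertices and at most one
self-loop at each vertex, encoded as a symmetric adjacency relation. -/
structure LoopyGraph (V : Type) where
  Adj : V → V → Prop
  symm : ∀ u v : V, Adj u v → Adj v u

namespace LoopyGraph

variable {V : Type}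

/-- The neighbors of `u` (vertices other than `u` adjacent to `u`). -/
def nbr (G : LoopyGraph V) (u : V) : Set V := {v | v ≠ u ∧ G.Adj u v}

/-- Degree of a vertex: each self-loop contributes `2`. -/
noncomputable def deg (G : LoopyGraph V) (u : V) : ℕ :=
  (G.nbr u).ncard + (if G.Adj u u then 2 else 0)

/-- `G₂` is obtained from `G₁` by a single valid double edge swap
`(u,v),(x,y) ⤳ (u,x),(v,y)`: the two removed edges are distinct edges of `G₁`, the two
added edges are distinct and not already present (no multiedge and no doubled
self-loop is created). -/
def DoubleEdgeSwap (G₁ G₂ : LoopyGraph V) : Prop :=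
  ∃ u v x y : V,
    G₁.Adj u v ∧ G₁.Adj x y ∧
    s(u, v) ≠ s(x, y) ∧
    ¬ G₁.Adj u x ∧ ¬ G₁.Adj v y ∧ s(u, x) ≠ s(v, y) ∧
    ∀ a b : V, G₂.Adj a b ↔
      ((G₁.Adj a b ∧ s(a, b) ≠ s(u, v) ∧ s(a, b) ≠ s(x, y)) ∨
        s(a, b) = s(u, x) ∨ s(a, b) = s(v, y))

/-- `G₂` is reachable from `G₁` by a finite sequence of valid double edge swaps. -/
def Reach (G₁ G₂ : LoopyGraph V) : Prop :=
  Relation.ReflTransGen DoubleEdgeSwap G₁ G₂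

/-- Vertices at (shortest-path) distance at most `k` from the set of loop-free vertices. -/
def within (G : LoopyGraph V) : ℕ → Set V
  | 0 => {v | ¬ G.Adj v v}
  | (k + 1) => within G k ∪ {v | ∃ u ∈ within G k, G.Adj v u}

/-- `Vset G 0 = V^0` is the set of vertices with no self-loop; for `k ≥ 1`,
`Vset G k = V^k` is the set of vertices (necessarily carrying a self-loop) whose
shortest-path distance to `V^0` is exactly `k`. -/
def Vset (G : LoopyGraph V) : ℕ → Set V
  | 0 => {v | ¬ G.Adj v v}
  | (k + 1) => within G (k + 1) \ within G k

/-- `V^∞`: vertices (with a self-loop) having no path to `V^0`. -/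
def Vinf (G : LoopyGraph V) : Set V := {v | ∀ k : ℕ, v ∉ within G k}

/-- A set of vertices is a clique when all pairs of distinct members are adjacent. -/
def IsClique (G : LoopyGraph V) (s : Set V) : Prop :=
  ∀ x ∈ s, ∀ y ∈ s, x ≠ y → G.Adj x y

/-- The set of vertices carrying a self-loop. -/
def selfLoops (G : LoopyGraph V) : Set V := {v | G.Adj v v}

/-- The edges of `G` with both endpoints in `V^0`. -/
def V0edges (G : LoopyGraph V) : Set (Sym2 V) :=
  {e | ∃ u v : V, e = s(u, v) ∧ G.Adj u v ∧ u ∈ Vset G 0 ∧ v ∈ Vset G 0}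

/-- `Ĝ` is swap-maximal: among all loopy graphs reachable from it by double edge swaps it
has the maximum number of self-loops, and subject to that the maximum number of edges with
both endpoints in `V^0`. -/
def SwapMaximal (G : LoopyGraph V) : Prop :=
  ∀ H : LoopyGraph V, Reach G H →
    (selfLoops H).ncard ≤ (selfLoops G).ncard ∧
      ((selfLoops H).ncard = (selfLoops G).ncard →
        (V0edges H).ncard ≤ (V0edges G).ncard)

/-- `K` is a largest clique contained in `V^0`, and it has exactly `d` vertices. -/
def LargestV0Clique (G : LoopyGraph V) (K : Set V) (d : ℕ) : Prop :=
  K ⊆ Vset G 0 ∧ IsClique G K ∧ K.ncard = d ∧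
    ∀ K' : Set V, K' ⊆ Vset G 0 → IsClique G K' → K'.ncard ≤ d

/-- Class `Q1`. -/
def Q1 (G : LoopyGraph V) : Prop :=
  ∃ K : Set V, K ⊆ Vset G 0 ∧ 4 ≤ K.ncard ∧ IsClique G K ∧
    (∀ u ∈ Vset G 0, (∀ w ∈ Vset G 0, ¬ G.Adj u w) ∨ u ∈ K) ∧
    IsClique G (Vset G 1 ∪ K) ∧
    Vset G 2 = ∅ ∧ Vinf G = ∅

/-- Class `Q2`. -/
def Q2 (G : LoopyGraph V) : Prop :=
  3 ≤ {u | u ∈ Vset G 0 ∧ (nbr G u ∩ Vset G 0).ncard = 2}.ncard ∧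
  (∀ u ∈ Vset G 0,
      (∀ w ∈ Vset G 0, ¬ G.Adj u w) ∨
        ((nbr G u ∩ Vset G 0).ncard = 2 ∧ ∀ w ∈ Vset G 1, G.Adj u w)) ∧
  IsClique G (Vset G 1) ∧
  (∀ u ∈ Vset G 2, nbr G u = Vset G 1) ∧
  Vset G 3 = ∅ ∧
  (Vinf G = ∅ ∨ (Vset G 1 = ∅ ∧ ∀ u ∈ Vinf G, deg G u = 2))

/-- The graph of loopy graphs `𝒢({k_i})` is connected: any two loopy graphs with degree
sequence `k` are linked by a finite sequence of valid double edge swaps. -/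
def GConnected (k : V → ℕ) : Prop :=
  ∀ G₁ G₂ : LoopyGraph V, (∀ v, deg G₁ v = k v) → (∀ v, deg G₂ v = k v) →
    Reach G₁ G₂

/-- `G₂` is obtained from `G₁` by a single valid triangle-loop swap: either a triangle on
three distinct vertices is replaced by three self-loops, or conversely. -/
def TriangleLoopSwap (G₁ G₂ : LoopyGraph V) : Prop :=
  ∃ u v w : V, u ≠ v ∧ v ≠ w ∧ u ≠ w ∧
    ((G₁.Adj u v ∧ G₁.Adj v w ∧ G₁.Adj w u ∧
        ¬ G₁.Adj u u ∧ ¬ G₁.Adj v v ∧ ¬ G₁.Adj w w ∧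
        ∀ a b : V, G₂.Adj a b ↔
          ((G₁.Adj a b ∧ s(a, b) ≠ s(u, v) ∧ s(a, b) ≠ s(v, w) ∧ s(a, b) ≠ s(w, u)) ∨
            s(a, b) = s(u, u) ∨ s(a, b) = s(v, v) ∨ s(a, b) = s(w, w))) ∨
      (G₁.Adj u u ∧ G₁.Adj v v ∧ G₁.Adj w w ∧
        ¬ G₁.Adj u v ∧ ¬ G₁.Adj v w ∧ ¬ G₁.Adj w u ∧
        ∀ a b : V, G₂.Adj a b ↔
          ((G₁.Adj a b ∧ s(a, b) ≠ s(u, u) ∧ s(a, b) ≠ s(v, v) ∧ s(a, b) ≠ s(w, w)) ∨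
            s(a, b) = s(u, v) ∨ s(a, b) = s(v, w) ∨ s(a, b) = s(w, u))))

/-- Reachability in the augmented graph of loopy graphs `𝒢_△`: a finite sequence of moves,
each a valid double edge swap or a valid triangle-loop swap. -/
def ReachTri (G₁ G₂ : LoopyGraph V) : Prop :=
  Relation.ReflTransGen
    (fun H₁ H₂ => DoubleEdgeSwap H₁ H₂ ∨ TriangleLoopSwap H₁ H₂) G₁ G₂

/-- `S` is a set of highest-degree vertices for the degree sequence `k`. -/
def TopSet (k : V → ℕ) (S : Set V) : Prop :=
  ∀ u ∈ S, ∀ v : V, v ∉ S → k v ≤ k u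

/-- A loopy graph is simple when it has no self-loops. -/
def IsSimple (G : LoopyGraph V) : Prop := ∀ v : V, ¬ G.Adj v v

/-- `k` is the degree sequence of some simple graph. -/
def SimpleGraphical (k : V → ℕ) : Prop :=
  ∃ G : LoopyGraph V, IsSimple G ∧ ∀ v, deg G v = k v

/-- `k` is `m`-simple-graphical: subtracting `2` from each of the `m` largest entries
yields a simple-graphical sequence. -/
def MSimpleGraphical (k : V → ℕ) (m : ℕ) : Prop :=
  ∃ S : Set V, S.ncard = m ∧ TopSet k S ∧ (∀ v ∈ S, 2 ≤ k v) ∧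
    SimpleGraphical (fun v : V => if v ∈ S then k v - 2 else k v)

/-- `m` is `m*`, the maximum `m` for which the sequence is `m`-simple-graphical. -/
def IsMStar (k : V → ℕ) (m : ℕ) : Prop :=
  MSimpleGraphical k m ∧ ∀ m' : ℕ, MSimpleGraphical k m' → m' ≤ m

/-- `G` is `m`-loopy: it has self-loops exactly at `m` highest-degree vertices. -/
def MLoopy (G : LoopyGraph V) (m : ℕ) : Prop :=
  (selfLoops G).ncard = m ∧ TopSet (deg G) (selfLoops G)

end LoopyGraph

/-- In a swap-maximal loopy graph, for `u ∈ V^0` and `v, x ∈ N(u)` with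
`x ≠ v`, the edge `(v,x)` is present (no open wedge centered at a loop-free vertex). -/
theorem swap_maximal_no_open_wedge {V : Type} [Fintype V] (G : LoopyGraph V)
    (hmax : G.SwapMaximal) :
    ∀ u ∈ LoopyGraph.Vset G 0, ∀ v ∈ G.nbr u, ∀ x ∈ G.nbr u, x ≠ v → G.Adj v x := by
  intro u hu v hv x hx hxv
  obtain ⟨hvu, huv⟩ := hv
  obtain ⟨hxu, hux⟩ := hx
  replace hu : ¬ G.Adj u u := hu
  by_contra hvx
  let H : LoopyGraph V :=
    { Adj := fun a b => (G.Adj a b ∧ s(a, b) ≠ s(u, v) ∧ s(a, b) ≠ s(u, x)) ∨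
        s(a, b) = s(u, u) ∨ s(a, b) = s(v, x)
      symm := fun a b h => by
        rw [Sym2.eq_swap (a := b)]
        exact h.imp_left fun h => ⟨G.symm _ _ h.1, h.2⟩ }
  have hswap : G.DoubleEdgeSwap H := by
    refine ⟨u, v, u, x, huv, hux, ?_, hu, hvx, ?_, fun _ _ => Iff.rfl⟩
    · simp only [ne_eq, Sym2.eq_iff]
      grind
    · simp only [ne_eq, Sym2.eq_iff]
      grind
  have hsub : G.selfLoops ⊂ H.selfLoops := by
    refine (Set.ssubset_iff_of_subset ?_).2 ⟨u, Or.inr (Or.inl rfl), hu⟩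
    intro a ha
    refine Or.inl ⟨ha, ?_, ?_⟩ <;> simp only [ne_eq, Sym2.eq_iff] <;> grind
  exact (Set.ncard_lt_ncard hsub (Set.toFinite _)).not_ge
    (hmax H (Relation.ReflTransGen.single hswap)).1
end

section
/- Let Ĝ be a swap-maximal loopy graph. If there exists a vertex u ∈ V^0 with degree at least 2, then every edge of Ĝ that is not a self-loop has at least one endpoint in V^0 ∪ V^1 ∪ V^2. -/
open scoped Classical

namespace LoopyGraph

variable {V : Type}

/-- The graph obtained by replacing the edges `(u,v)` and `(x,y)` by `(u,x)` and `(v,y)`. -/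
def swap (G : LoopyGraph V) (u v x y : V) : LoopyGraph V where
  Adj a b := (G.Adj a b ∧ s(a, b) ≠ s(u, v) ∧ s(a, b) ≠ s(x, y)) ∨
    s(a, b) = s(u, x) ∨ s(a, b) = s(v, y)
  symm a b h := by
    rw [Sym2.eq_swap (a := b)]
    exact h.imp_left (And.imp_left (G.symm a b))

lemma mem_Vset_of_mem_within_two (G : LoopyGraph V) {a : V} (h : a ∈ within G 2) :
    a ∈ Vset G 0 ∪ Vset G 1 ∪ Vset G 2 := by
  by_cases h1 : a ∈ within G 1
  · by_cases h0 : a ∈ within G 0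
    · exact Or.inl (Or.inl h0)
    · exact Or.inl (Or.inr ⟨h1, h0⟩)
  · exact Or.inr ⟨h, h1⟩

/-- In a swap-maximal graph no reachable graph has strictly more self-loops. -/
lemma SwapMaximal.not_adj_self_of_reach [Finite V] {G H : LoopyGraph V} (hmax : G.SwapMaximal)
    (hH : Reach G H) (hsub : ∀ c, G.Adj c c → H.Adj c c) {u : V} (hu : ¬ G.Adj u u) :
    ¬ H.Adj u u := fun hHu =>
  (hmax H hH).1.not_gt <| Set.ncard_lt_ncard
    ⟨fun c hc => hsub c hc, fun h => hu (h hHu)⟩ (Set.toFinite _)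

end LoopyGraph

/-- In a swap-maximal loopy graph having a vertex `u ∈ V^0` of degree ≥ 2,
every non-self-loop edge has at least one endpoint in `V^0 ∪ V^1 ∪ V^2`. -/
theorem swap_maximal_edges_near_V0 {V : Type} [Fintype V] (G : LoopyGraph V)
    (hmax : G.SwapMaximal) (hu : ∃ u ∈ LoopyGraph.Vset G 0, 2 ≤ G.deg u) :
    ∀ a b : V, G.Adj a b → a ≠ b →
      a ∈ LoopyGraph.Vset G 0 ∪ LoopyGraph.Vset G 1 ∪ LoopyGraph.Vset G 2 ∨
        b ∈ LoopyGraph.Vset G 0 ∪ LoopyGraph.Vset G 1 ∪ LoopyGraph.Vset G 2 := by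
  obtain ⟨u, hu0, hdeg⟩ := hu
  have huu : ¬ G.Adj u u := hu0
  have hcard : 1 < (G.nbr u).ncard := by
    simp only [LoopyGraph.deg, huu, if_false] at hdeg
    omega
  obtain ⟨v, ⟨hvu, huv⟩, w, ⟨hwu, huw⟩, hvw⟩ := (Set.one_lt_ncard (Set.toFinite _)).1 hcard
  intro a b hab hne
  by_contra! hcon
  have hnear : ∀ v, G.Adj u v → v ∈ LoopyGraph.within G 1 := fun v h =>
    Or.inr ⟨u, hu0, G.symm _ _ h⟩
  have hfar : ∀ c, c ∉ LoopyGraph.within G 2 →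
      c ≠ u ∧ ¬ G.Adj u c ∧ ∀ v, G.Adj u v → c ≠ v ∧ ¬ G.Adj v c := by
    intro c hc
    refine ⟨?_, fun h => hc (Or.inl (hnear c h)), fun v hv => ⟨?_, fun h =>
      hc (Or.inr ⟨v, hnear v hv, G.symm _ _ h⟩)⟩⟩
    · rintro rfl
      exact hc (Or.inl (Or.inl hu0))
    · rintro rfl
      exact hc (Or.inl (hnear c hv))
  obtain ⟨hau, hua, ha⟩ := hfar a fun h => hcon.1 (G.mem_Vset_of_mem_within_two h)
  obtain ⟨hbu, hub, hb⟩ := hfar b fun h => hcon.2 (G.mem_Vset_of_mem_within_two h)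
  obtain ⟨hav, hva⟩ := ha v huv
  obtain ⟨haw, hwa⟩ := ha w huw
  obtain ⟨hbv, hvb⟩ := hb v huv
  have h₁ : LoopyGraph.DoubleEdgeSwap G (G.swap u v a b) := by
    refine ⟨u, v, a, b, huv, hab, ?_, hua, hvb, ?_, fun _ _ => Iff.rfl⟩ <;>
      simp only [ne_eq, Sym2.eq_iff] <;> grind
  have h₂ : LoopyGraph.DoubleEdgeSwap (G.swap u v a b) ((G.swap u v a b).swap u w u a) := by
    refine ⟨u, w, u, a, ?_, ?_, ?_, ?_, ?_, ?_, fun _ _ => Iff.rfl⟩ <;>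
      simp only [LoopyGraph.swap, ne_eq, Sym2.eq_iff] <;> grind
  refine hmax.not_adj_self_of_reach ((Relation.ReflTransGen.single h₁).tail h₂) ?_ huu ?_
  · intro c hc
    simp only [LoopyGraph.swap, ne_eq, Sym2.eq_iff]
    grind
  · exact Or.inr (Or.inl rfl)
end

section
/- Let Ĝ^1 be a swap-maximal loopy graph whose largest clique K^0 contained in V^0 has exactly 1 vertex (V^0 is nonempty and contains no edges), and suppose that every vertex of V^0 has degree at most that of every vertex not in V^0. Then Ĝ^1 is m*-loopy: it has self-loops exactly at the m* highest-degree vertices. -/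
open scoped Classical

namespace LoopyGraph

variable {V : Type}

/-- The graph obtained from `G` by replacing the edges `(u,v)`, `(x,y)` by `(u,x)`, `(v,y)`. -/
def edgeSwap (G : LoopyGraph V) (u v x y : V) : LoopyGraph V where
  Adj a b := (G.Adj a b ∧ s(a, b) ≠ s(u, v) ∧ s(a, b) ≠ s(x, y)) ∨
    s(a, b) = s(u, x) ∨ s(a, b) = s(v, y)
  symm _ b h := by
    rw [Sym2.eq_swap (a := b)]
    exact h.imp_left fun h => ⟨G.symm _ _ h.1, h.2⟩

/-- The graph obtained from `G` by deleting all self-loops. -/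
def removeLoops (G : LoopyGraph V) : LoopyGraph V where
  Adj a b := a ≠ b ∧ G.Adj a b
  symm _ _ h := ⟨h.1.symm, G.symm _ _ h.2⟩

/-- The graph `G` transported along a permutation of its vertices. -/
def permute (G : LoopyGraph V) (e : Equiv.Perm V) : LoopyGraph V where
  Adj a b := G.Adj (e a) (e b)
  symm _ _ h := G.symm _ _ h

/-- The ordered pairs on which the adjacency relations of `G` and `H` disagree. -/
def disagree (G H : LoopyGraph V) : Set (V × V) := {p | ¬ (G.Adj p.1 p.2 ↔ H.Adj p.1 p.2)}

lemma adj_comm (G : LoopyGraph V) (a b : V) : G.Adj a b ↔ G.Adj b a :=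
  ⟨G.symm _ _, G.symm _ _⟩

lemma edgeSwap_spec {G : LoopyGraph V} {u v x y : V} (huv : G.Adj u v) (hxy : G.Adj x y)
    (hne : s(u, v) ≠ s(x, y)) (hux : ¬ G.Adj u x) (hvy : ¬ G.Adj v y)
    (hne' : s(u, x) ≠ s(v, y)) : DoubleEdgeSwap G (G.edgeSwap u v x y) :=
  ⟨u, v, x, y, huv, hxy, hne, hux, hvy, hne', fun _ _ => Iff.rfl⟩

lemma nbr_edgeSwap_of_eq {G : LoopyGraph V} {u v x y : V} (huv : u ≠ v) (hux : u ≠ x)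
    (huy : u ≠ y) : nbr (G.edgeSwap u v x y) u = insert x (nbr G u \ {v}) := by
  ext w
  simp only [nbr, edgeSwap, Set.mem_ofPred_eq, Set.mem_insert_iff, Set.mem_sdiff,
    Set.mem_singleton_iff, Sym2.eq_iff, ne_eq]
  grind

lemma edgeSwap_flip (G : LoopyGraph V) (u v x y : V) :
    G.edgeSwap u v x y = G.edgeSwap v u y x := by
  simp only [edgeSwap, mk.injEq]
  funext a b
  rw [Sym2.eq_swap (a := u) (b := v), Sym2.eq_swap (a := x) (b := y)]
  exact propext (or_congr_right or_comm)

lemma edgeSwap_exchange (G : LoopyGraph V) (u v x y : V) :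
    G.edgeSwap u v x y = G.edgeSwap x y u v := by
  simp only [edgeSwap, mk.injEq]
  funext a b
  rw [Sym2.eq_swap (a := u) (b := x), Sym2.eq_swap (a := v) (b := y)]
  exact propext (or_congr_left (and_congr_right fun _ => and_comm))

lemma ncard_nbr_edgeSwap [Finite V] {G : LoopyGraph V} {u v x y : V} (huv : G.Adj u v)
    (hxy : G.Adj x y) (hux : ¬ G.Adj u x) (hvy : ¬ G.Adj v y)
    (n1 : u ≠ v) (n2 : u ≠ x) (n3 : u ≠ y) (n4 : v ≠ x) (n5 : v ≠ y) (n6 : x ≠ y) (w : V) :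
    (nbr (G.edgeSwap u v x y) w).ncard = (nbr G w).ncard := by
  have key : ∀ {u v x y : V}, G.Adj u v → ¬ G.Adj u x → u ≠ v → u ≠ x → u ≠ y →
      (nbr (G.edgeSwap u v x y) u).ncard = (nbr G u).ncard := by
    intro u v x y huv hux n1 n2 n3
    rw [nbr_edgeSwap_of_eq n1 n2 n3]
    exact Set.ncard_exchange (fun h => hux h.2) ⟨n1.symm, huv⟩
  by_cases h1 : w = u
  · subst h1
    exact key huv hux n1 n2 n3
  by_cases h2 : w = v
  · subst h2
    rw [edgeSwap_flip]
    exact key (G.symm _ _ huv) hvy n1.symm n5 n4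
  by_cases h3 : w = x
  · subst h3
    rw [edgeSwap_exchange]
    exact key hxy (fun h => hux (G.symm _ _ h)) n6 n2.symm n4.symm
  by_cases h4 : w = y
  · subst h4
    rw [edgeSwap_exchange, edgeSwap_flip]
    exact key (G.symm _ _ hxy) (fun h => hvy (G.symm _ _ h)) n6.symm n5.symm n3.symm
  congr 1
  ext z
  simp only [nbr, edgeSwap, Set.mem_ofPred_eq, Sym2.eq_iff, ne_eq]
  grind

lemma edgeSwap_adj_self {G : LoopyGraph V} {u v x y : V}
    (n1 : u ≠ v) (n2 : u ≠ x) (n5 : v ≠ y) (n6 : x ≠ y) (w : V) :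
    (G.edgeSwap u v x y).Adj w w ↔ G.Adj w w := by
  simp only [edgeSwap, Sym2.eq_iff, ne_eq]
  grind

lemma ncard_lt_of_three_fixed [Finite V] {D D' : Set (V × V)} {t a b c : V}
    (hta : (t, a) ∈ D) (hab : (a, b) ∈ D) (hbc : (b, c) ∈ D)
    (htb : t ≠ b) (hat : a ≠ t) (hne : a ≠ b)
    (h : ∀ p ∈ D', (p ∈ D ∧ p ≠ (t, a) ∧ p ≠ (a, b) ∧ p ≠ (b, c)) ∨ p = (t, c) ∨ p = (c, t)) :
    D'.ncard < D.ncard := by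
  set F : Set (V × V) := {(t, a), (a, b), (b, c)} with hF
  have hF3 : F.ncard = 3 := by
    rw [hF, Set.ncard_eq_three]
    exact ⟨_, _, _, by grind, by grind, by grind, rfl⟩
  have hFD : F ⊆ D := by
    rintro p (rfl | rfl | rfl) <;> assumption
  have hsub : D' ⊆ (D \ F) ∪ {(t, c), (c, t)} := by
    intro p hp
    rcases h p hp with h | h | h
    · exact Or.inl ⟨h.1, by grind⟩
    · exact Or.inr (Or.inl h)
    · exact Or.inr (Or.inr h)
  have h1 := Set.ncard_le_ncard hsub (Set.toFinite _)
  have h2 := Set.ncard_union_le (D \ F) {(t, c), (c, t)}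
  have h3 := Set.ncard_insert_le (t, c) {(c, t)}
  rw [Set.ncard_singleton] at h3
  have h4 := Set.ncard_sdiff_add_ncard_of_subset hFD
  omega

/-- If all loopy graphs obtained from `G` by swaps have at most as many self-loops as `G`, then
the neighbors of a loop-free vertex form a clique. -/
lemma adj_of_adj_loopfree [Finite V] {G : LoopyGraph V}
    (hloops : ∀ G', Reach G G' → (selfLoops G').ncard ≤ (selfLoops G).ncard)
    {t a b : V} (ht : ¬ G.Adj t t) (hta : G.Adj t a) (htb : G.Adj t b) (hab : a ≠ b) :
    G.Adj a b := by
  by_contra hnab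
  have hat : a ≠ t := by rintro rfl; exact ht hta
  have hbt : b ≠ t := by rintro rfl; exact ht htb
  have hs : DoubleEdgeSwap G (G.edgeSwap t a t b) := by
    apply edgeSwap_spec hta htb _ ht hnab
    · simp only [ne_eq, Sym2.eq_iff]; grind
    · simp only [ne_eq, Sym2.eq_iff]; grind
  have h1 := hloops _ (Relation.ReflTransGen.single hs)
  have h2 : selfLoops (G.edgeSwap t a t b) = insert t (selfLoops G) := by
    ext w
    simp only [selfLoops, edgeSwap, Sym2.eq_iff, ne_eq, Set.mem_ofPred_eq, Set.mem_insert_iff]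
    grind
  rw [h2, Set.ncard_insert_of_notMem (s := selfLoops G) ht] at h1
  omega

lemma ncard_nbr_eq [Fintype V] (G : LoopyGraph V) (v : V) :
    (nbr G v).ncard = (Finset.univ.filter fun w => w ≠ v ∧ G.Adj v w).card := by
  rw [← Set.ncard_coe_finset]
  congr 1
  ext w
  simp [nbr]

lemma card_only_add_ncard_nbr [Fintype V] (G H : LoopyGraph V) (v : V) :
    (Finset.univ.filter fun w => w ≠ v ∧ G.Adj v w ∧ ¬ H.Adj v w).card + (nbr H v).ncard =
    (Finset.univ.filter fun w => w ≠ v ∧ H.Adj v w ∧ ¬ G.Adj v w).card + (nbr G v).ncard := by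
  rw [ncard_nbr_eq, ncard_nbr_eq,
    ← Finset.card_filter_add_card_filter_not (s := Finset.univ.filter fun w => w ≠ v ∧ H.Adj v w)
      (fun w => G.Adj v w),
    ← Finset.card_filter_add_card_filter_not (s := Finset.univ.filter fun w => w ≠ v ∧ G.Adj v w)
      (fun w => H.Adj v w)]
  simp only [Finset.filter_filter, and_assoc]
  have : (Finset.univ.filter fun w => w ≠ v ∧ H.Adj v w ∧ G.Adj v w) =
      Finset.univ.filter fun w => w ≠ v ∧ G.Adj v w ∧ H.Adj v w :=
    Finset.filter_congr fun w _ => by tauto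
  rw [this]
  omega

/-- A loopy graph that is maximal with respect to self-loops, and all of whose equally loopy
swap-descendants have no edges between loop-free vertices, cannot dominate the degrees of a simple
graph strictly at some vertex while agreeing with them on all vertices with self-loops. -/
theorem not_ncard_nbr_lt_of_maximal [Fintype V] (H G : LoopyGraph V)
    (hloops : ∀ G', Reach G G' → (selfLoops G').ncard ≤ (selfLoops G).ncard)
    (hindep : ∀ G', Reach G G' → selfLoops G' = selfLoops G →
      ∀ u v, G'.Adj u v → G'.Adj u u ∨ G'.Adj v v)
    (hH : IsSimple H) (hle : ∀ v, (nbr H v).ncard ≤ (nbr G v).ncard)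
    (heq : ∀ v, G.Adj v v → (nbr H v).ncard = (nbr G v).ncard)
    (t : V) : ¬ (nbr H t).ncard < (nbr G t).ncard := by
  induction hn : (disagree G H).ncard using Nat.strong_induction_on generalizing G H with
  | _ n ih =>
  intro hlt
  subst hn
  have htt : ¬ G.Adj t t := fun h => hlt.ne (heq t h)
  obtain ⟨red, hred⟩ : ∃ red : V → V → Prop, ∀ u v, red u v ↔
      (v ≠ u ∧ G.Adj u v ∧ ¬ H.Adj u v) := ⟨_, fun _ _ => Iff.rfl⟩
  obtain ⟨blue, hblue⟩ : ∃ blue : V → V → Prop, ∀ u v, blue u v ↔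
      (v ≠ u ∧ H.Adj u v ∧ ¬ G.Adj u v) := ⟨_, fun _ _ => Iff.rfl⟩
  have red_comm : ∀ u v, red u v ↔ red v u := fun u v => by
    simp only [hred, G.adj_comm u v, H.adj_comm u v, ne_comm]
  have blue_comm : ∀ u v, blue u v ↔ blue v u := fun u v => by
    simp only [hblue, G.adj_comm u v, H.adj_comm u v, ne_comm]
  have hcount : ∀ v, (Finset.univ.filter (red v)).card + (nbr H v).ncard =
      (Finset.univ.filter (blue v)).card + (nbr G v).ncard := fun v => by
    convert card_only_add_ncard_nbr G H v using 4
    · exact hred v _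
    · exact hblue v _
  have hloop_of_adj : ∀ a, G.Adj t a → G.Adj a a := fun a ha =>
    (hindep G Relation.ReflTransGen.refl rfl t a ha).resolve_left htt
  have hclosed : ∀ a b c, red t a → blue a b → red b c → red t c := by
    intro a b c hta hab hbc
    obtain ⟨hat, gta, nhta⟩ := (hred _ _).1 hta
    obtain ⟨hba, hhab, ngab⟩ := (hblue _ _).1 hab
    obtain ⟨hcb, gbc, nhbc⟩ := (hred _ _).1 hbc
    have gcb := G.symm _ _ gbc
    have nhcb : ¬ H.Adj c b := fun h => nhbc (H.symm _ _ h)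
    have hbt : b ≠ t := by rintro rfl; exact ngab (G.symm _ _ gta)
    have hca : c ≠ a := by rintro rfl; exact ngab gcb
    have hct : c ≠ t := by
      rintro rfl
      exact ngab (adj_of_adj_loopfree hloops htt gta gcb hba.symm)
    by_contra hnred
    by_cases gtc : G.Adj t c
    · have htc : H.Adj t c := by
        by_contra h
        exact hnred ((hred _ _).2 ⟨hct, gtc, h⟩)
      have hdeg := ncard_nbr_edgeSwap htc hhab nhta nhcb hct.symm hat.symm hbt.symm hca hcb
        hba.symm
      have hself := edgeSwap_adj_self (G := H) hct.symm hat.symm hcb hba.symm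
      refine ih _ ?_ (H.edgeSwap t c a b) G hloops hindep (fun v => ?_) (fun v => ?_)
        (fun v hv => ?_) rfl ?_
      · refine ncard_lt_of_three_fixed (t := t) (a := a) (b := b) (c := c) ?_ ?_ ?_ hbt.symm hat
          hba.symm ?_
        · simp [disagree, gta, nhta]
        · simp [disagree, hhab, ngab]
        · simp [disagree, gbc, nhbc]
        · rintro ⟨p, q⟩ hpq
          simp only [disagree, edgeSwap, Set.mem_ofPred_eq, Sym2.eq_iff, ne_eq,
            Prod.mk.injEq] at hpq ⊢
          have := H.symm
          have := G.symm
          grind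
      · rw [hself]
        exact hH v
      · rw [hdeg]
        exact hle v
      · rw [hdeg]
        exact heq v hv
      · rw [hdeg]
        exact hlt
    · have hdeg := ncard_nbr_edgeSwap gta gcb gtc ngab hat.symm hct.symm hbt.symm hca.symm
        hba.symm hcb
      have hself := edgeSwap_adj_self (G := G) hat.symm hct.symm hba.symm hcb
      have hS : selfLoops (G.edgeSwap t a c b) = selfLoops G := Set.ext hself
      have hreach : Reach G (G.edgeSwap t a c b) := by
        refine Relation.ReflTransGen.single (edgeSwap_spec gta gcb ?_ gtc ngab ?_)
        · simp only [ne_eq, Sym2.eq_iff]; grind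
        · simp only [ne_eq, Sym2.eq_iff]; grind
      refine ih _ ?_ H (G.edgeSwap t a c b) (fun G' h => ?_) (fun G' h hG' => ?_) hH (fun v => ?_)
        (fun v hv => ?_) rfl ?_
      · refine ncard_lt_of_three_fixed (t := t) (a := a) (b := b) (c := c) ?_ ?_ ?_ hbt.symm hat
          hba.symm ?_
        · simp [disagree, gta, nhta]
        · simp [disagree, hhab, ngab]
        · simp [disagree, gbc, nhbc]
        · rintro ⟨p, q⟩ hpq
          simp only [disagree, edgeSwap, Set.mem_ofPred_eq, Sym2.eq_iff, ne_eq,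
            Prod.mk.injEq] at hpq ⊢
          have := H.symm
          have := G.symm
          grind
      · rw [hS]
        exact hloops G' (hreach.trans h)
      · exact hindep G' (hreach.trans h) (hG'.trans hS)
      · rw [hdeg]
        exact hle v
      · rw [hdeg]
        exact heq v ((hself v).1 hv)
      · rw [hdeg]
        exact hlt
  set A : Finset V := Finset.univ.filter (red t) with hA
  have hmemA : ∀ a, a ∈ A ↔ red t a := fun a => by simp [hA]
  have hApos : 0 < A.card := by
    have := hcount t
    rw [← hA] at this
    omega
  have hbal : ∑ a ∈ A, (Finset.univ.filter (red a)).card =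
      ∑ a ∈ A, (Finset.univ.filter (blue a)).card := by
    refine Finset.sum_congr rfl fun a ha => ?_
    have h1 := hcount a
    have h2 := heq a (hloop_of_adj a ((hred _ _).1 ((hmemA a).1 ha)).2.1)
    omega
  have hred_sum : ∑ a ∈ A, (Finset.univ.filter (red a)).card =
      ∑ b, (A.bipartiteBelow red b).card := Finset.sum_card_bipartiteAbove_eq_sum_card_bipartiteBelow
    (s := A) (t := Finset.univ) red
  have hblue_sum : ∑ a ∈ A, (Finset.univ.filter (blue a)).card =
      ∑ b, (A.bipartiteBelow blue b).card := Finset.sum_card_bipartiteAbove_eq_sum_card_bipartiteBelow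
    (s := A) (t := Finset.univ) blue
  have hlt_sum : ∑ b, (A.bipartiteBelow blue b).card < ∑ b, (A.bipartiteBelow red b).card := by
    refine Finset.sum_lt_sum (fun b _ => ?_) ⟨t, Finset.mem_univ _, ?_⟩
    · rcases (A.bipartiteBelow blue b).eq_empty_or_nonempty with h | ⟨a, ha⟩
      · simp [h]
      obtain ⟨haA, hab⟩ := Finset.mem_filter.1 ha
      have h1 : Finset.univ.filter (red b) ⊆ A.bipartiteBelow red b := by
        intro c hc
        have hc := (Finset.mem_filter.1 hc).2
        exact Finset.mem_filter.2
          ⟨(hmemA c).2 (hclosed a b c ((hmemA a).1 haA) hab hc), (red_comm _ _).1 hc⟩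
      have h2 : A.bipartiteBelow blue b ⊆ Finset.univ.filter (blue b) := by
        intro c hc
        exact Finset.mem_filter.2
          ⟨Finset.mem_univ _, (blue_comm _ _).1 (Finset.mem_filter.1 hc).2⟩
      have h3 := Finset.card_le_card h1
      have h4 := Finset.card_le_card h2
      have h5 := hcount b
      have h6 := hle b
      omega
    · have h1 : A.bipartiteBelow blue t = ∅ := by
        refine Finset.filter_eq_empty_iff.2 fun a ha hb => ?_
        exact ((hblue _ _).1 ((blue_comm _ _).1 hb)).2.2 ((hred _ _).1 ((hmemA a).1 ha)).2.1
      have h2 : A.bipartiteBelow red t = A :=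
        Finset.filter_true_of_mem fun a ha => (red_comm _ _).1 ((hmemA a).1 ha)
      rw [h1, h2]
      simpa using hApos
  omega

lemma deg_of_isSimple {G : LoopyGraph V} (hG : IsSimple G) (v : V) :
    deg G v = (nbr G v).ncard := by
  simp [deg, hG v]

lemma ncard_nbr_add_two {G : LoopyGraph V} {v : V} (hv : G.Adj v v) :
    (nbr G v).ncard + 2 = deg G v := by
  simp [deg, hv]

lemma ncard_nbr_of_not_adj_self {G : LoopyGraph V} {v : V} (hv : ¬ G.Adj v v) :
    (nbr G v).ncard = deg G v := by
  simp [deg, hv]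

lemma isSimple_removeLoops (G : LoopyGraph V) : IsSimple G.removeLoops := fun _ h => h.1 rfl

lemma nbr_removeLoops (G : LoopyGraph V) (v : V) : nbr G.removeLoops v = nbr G v := by
  ext w
  simp only [nbr, removeLoops, Set.mem_ofPred_eq]
  tauto

lemma ncard_nbr_permute (G : LoopyGraph V) (e : Equiv.Perm V) (v : V) :
    (nbr (G.permute e) v).ncard = (nbr G (e v)).ncard := by
  have : nbr (G.permute e) v = e ⁻¹' nbr G (e v) := by
    ext w
    simp [nbr, permute]
  rw [this, Set.ncard_preimage_of_injective_subset_range e.injective]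
  simp [e.surjective.range_eq]

/-- A loopy graph whose self-loops sit at highest-degree vertices witnesses that its degree
sequence is `m`-simple-graphical, with `m` its number of self-loops. -/
lemma mSimpleGraphical_selfLoops {G : LoopyGraph V} {k : V → ℕ} (hdeg : ∀ v, deg G v = k v)
    (htop : TopSet k (selfLoops G)) : MSimpleGraphical k (selfLoops G).ncard := by
  refine ⟨selfLoops G, rfl, htop, fun v hv => ?_, G.removeLoops, G.isSimple_removeLoops,
    fun v => ?_⟩
  · rw [← hdeg v, ← ncard_nbr_add_two hv]
    omega
  · rw [deg_of_isSimple G.isSimple_removeLoops, nbr_removeLoops]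
    dsimp only
    rw [← hdeg v]
    split_ifs with hv
    · rw [← ncard_nbr_add_two hv, Nat.add_sub_cancel]
    · exact ncard_nbr_of_not_adj_self hv

/-- The set of highest-degree vertices witnessing that a sequence is `m`-simple-graphical may be
chosen to contain any smaller set of highest-degree vertices. -/
lemma exists_superset_of_topSet [Finite V] {k : V → ℕ} {S T : Set V} (hS : TopSet k S)
    (hT : TopSet k T) (hcard : S.ncard ≤ T.ncard) (hT2 : ∀ v ∈ T, 2 ≤ k v)
    (hgr : SimpleGraphical fun v => if v ∈ T then k v - 2 else k v) :
    ∃ T' : Set V, S ⊆ T' ∧ T'.ncard = T.ncard ∧ (∀ v ∈ T', 2 ≤ k v) ∧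
      SimpleGraphical fun v => if v ∈ T' then k v - 2 else k v := by
  induction hn : (S \ T).ncard using Nat.strong_induction_on generalizing T with
  | _ n ih =>
  subst hn
  rcases (S \ T).eq_empty_or_nonempty with h | ⟨s, hsS, hsT⟩
  · exact ⟨T, Set.sdiff_eq_empty.1 h, rfl, hT2, hgr⟩
  obtain ⟨t, htT, htS⟩ : ∃ t ∈ T, t ∉ S := by
    by_contra! h
    exact hsT (Set.eq_of_subset_of_ncard_le h hcard ▸ hsS)
  have hst : k s = k t := le_antisymm (hT t htT s hsT) (hS s hsS t htS)
  have hne : s ≠ t := by rintro rfl; exact hsT htT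
  have hc : (insert s (T \ {t})).ncard = T.ncard := Set.ncard_exchange hsT htT
  have hlt : (S \ insert s (T \ {t})).ncard < (S \ T).ncard := by
    refine Set.ncard_lt_ncard ⟨?_, fun h => ?_⟩
    · rintro v ⟨hvS, hv⟩
      refine ⟨hvS, fun hvT => hv (Or.inr ⟨hvT, ?_⟩)⟩
      rintro rfl
      exact htS hvS
    · exact (h ⟨hsS, hsT⟩).2 (Or.inl rfl)
  have hTop' : TopSet k (insert s (T \ {t})) := by
    rintro u (rfl | ⟨huT, hut⟩) v hv
    · by_cases hvt : v = t
      · rw [hvt, hst]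
      · rw [hst]
        exact hT t htT v fun h => hv (Or.inr ⟨h, hvt⟩)
    · by_cases hvt : v = t
      · rw [hvt, ← hst]
        exact hT u huT s hsT
      · exact hT u huT v fun h => hv (Or.inr ⟨h, hvt⟩)
  have hT2' : ∀ v ∈ insert s (T \ {t}), 2 ≤ k v := by
    rintro u (rfl | ⟨huT, -⟩)
    · rw [hst]
      exact hT2 t htT
    · exact hT2 u huT
  have hgr' : SimpleGraphical fun v => if v ∈ insert s (T \ {t}) then k v - 2 else k v := by
    obtain ⟨H, hH, hHdeg⟩ := hgr
    have hH' : IsSimple (H.permute (Equiv.swap s t)) := fun v => hH _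
    refine ⟨H.permute (Equiv.swap s t), hH', fun v => ?_⟩
    rw [deg_of_isSimple hH', ncard_nbr_permute, ← deg_of_isSimple hH, hHdeg]
    by_cases hvs : v = s
    · subst hvs
      simp [htT, hst]
    by_cases hvt : v = t
    · subst hvt
      simp [hsT, hst, hne.symm]
    · rw [Equiv.swap_apply_of_ne_of_ne hvs hvt]
      simp [hvs, hvt]
  obtain ⟨T', h1, h2, h3⟩ := ih _ hlt (T := insert s (T \ {t})) hTop' (hc ▸ hcard) hT2'
    (by convert hgr') rfl
  exact ⟨T', h1, h2.trans hc, h3⟩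

end LoopyGraph

open LoopyGraph

/-- A swap-maximal loopy graph `Ĝ^1` (largest clique in `V^0` has exactly
one vertex) in which every vertex of `V^0` has degree at most that of every vertex not in
`V^0` is `m*`-loopy. -/
theorem Ghat1_is_mStar_loopy {V : Type} [Fintype V] (G : LoopyGraph V) (k : V → ℕ)
    (hdeg : ∀ v, G.deg v = k v) (hmax : G.SwapMaximal)
    (K : Set V) (hK : LoopyGraph.LargestV0Clique G K 1)
    (hdc : ∀ u ∈ LoopyGraph.Vset G 0, ∀ x : V, x ∉ LoopyGraph.Vset G 0 →
      G.deg u ≤ G.deg x)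
    (m : ℕ) (hm : LoopyGraph.IsMStar k m) :
    G.MLoopy m := by
  have htop : TopSet (deg G) (selfLoops G) := fun u hu v hv => hdc v hv u fun h => h hu
  obtain rfl : deg G = k := funext hdeg
  obtain ⟨⟨T, hTm, hTtop, hT2, hTgr⟩, hmub⟩ := hm
  have hle : (selfLoops G).ncard ≤ m := hmub _ (mSimpleGraphical_selfLoops hdeg htop)
  refine ⟨hle.antisymm (not_lt.1 fun hlt => ?_), htop⟩
  obtain ⟨T', hST, hT'm, hT'2, H, hH, hHdeg⟩ :=
    exists_superset_of_topSet htop hTtop (hTm ▸ hle) hT2 hTgr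
  obtain ⟨t, htT, htS⟩ : ∃ t ∈ T', t ∉ selfLoops G := by
    by_contra! h
    have := Set.ncard_le_ncard h (Set.toFinite _)
    omega
  have hV0 : V0edges G = ∅ := by
    refine Set.eq_empty_iff_forall_notMem.2 ?_
    rintro _ ⟨u, v, -, huv, hu, hv⟩
    have hne : u ≠ v := by rintro rfl; exact hu huv
    have := hK.2.2.2 {u, v} (by rintro x (rfl | rfl) <;> assumption) (by
      rintro x (rfl | rfl) y (rfl | rfl) hxy
      · exact absurd rfl hxy
      · exact huv
      · exact G.symm _ _ huv
      · exact absurd rfl hxy)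
    rw [Set.ncard_pair hne] at this
    omega
  have hnH : ∀ v, (nbr H v).ncard = if v ∈ T' then deg G v - 2 else deg G v := fun v => by
    rw [← deg_of_isSimple hH, hHdeg]
  refine not_ncard_nbr_lt_of_maximal H G (fun G' h => (hmax G' h).1)
    (fun G' h hG' u v huv => ?_) hH (fun v => ?_) (fun v hv => ?_) t ?_
  · by_contra! hcon
    have h1 := (hmax G' h).2 (by rw [hG'])
    rw [hV0, Set.ncard_empty, Nat.le_zero, Set.ncard_eq_zero (Set.toFinite _)] at h1
    exact (h1 ▸ (⟨u, v, rfl, huv, hcon.1, hcon.2⟩ : s(u, v) ∈ V0edges G') : s(u, v) ∈ (∅ : Set _))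
  · rw [hnH]
    by_cases hv : G.Adj v v
    · have := ncard_nbr_add_two hv
      rw [if_pos (hST hv)]
      omega
    · rw [ncard_nbr_of_not_adj_self hv]
      split_ifs <;> omega
  · have := ncard_nbr_add_two hv
    rw [hnH, if_pos (hST hv)]
    omega
  · have := hT'2 t htT
    rw [hnH, if_pos htT, ncard_nbr_of_not_adj_self htS]
    omega
end
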